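/- arXiv:2410.09251 — 4 statements merged into one kernel-verified Lean document; each statement's English description precedes it below -/
import Mathlib

section
/- Let (d_n)_{n ≥ 1} be a strictly increasing sequence of positive integers and (p_n)_{n ≥ 1} a sequence of pairwise distinct primes such that p_n does not divide d_m for any m, n ∈ ℕ. Let M be the Puiseux monoid generated by {1/(d_n p_n) : n ∈ ℕ}. Then M is atomic and its set of atoms is exactly {1/(d_n p_n) : n ∈ ℕ}. -/
/-- `c` divides `b` in the Puiseux monoid `M`, i.e., `b = c + d` for some `d ∈ M`. -/
def DvdIn (M : AddSubmonoid ℚ) (c b : ℚ) : Prop := ∃ d ∈ M, b = c + d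

/-- `e` is an invertible element (unit) of the monoid `M`. -/
def IsUnitIn (M : AddSubmonoid ℚ) (e : ℚ) : Prop := e ∈ M ∧ ∃ f ∈ M, e + f = 0

/-- `d` is a maximal common divisor of the subset `S` of `M`: `d ∈ M` is a common divisor
of `S` in `M`, and every common divisor in `M` of `{s - d : s ∈ S}` is a unit of `M`. -/
def IsMCDIn (M : AddSubmonoid ℚ) (d : ℚ) (S : Set ℚ) : Prop :=
  d ∈ M ∧ (∀ s ∈ S, DvdIn M d s) ∧
    ∀ e ∈ M, (∀ s ∈ S, DvdIn M e (s - d)) → IsUnitIn M e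

/-- `M` is a strong MCD monoid: every nonempty subset of `M` has a maximal common divisor. -/
def StronglyMCDIn (M : AddSubmonoid ℚ) : Prop :=
  ∀ S : Set ℚ, S.Nonempty → S ⊆ (M : Set ℚ) → ∃ d, IsMCDIn M d S

/-- The principal ideal `b + M` of `M`. -/
def PIdealIn (M : AddSubmonoid ℚ) (b : ℚ) : Set ℚ := {x | DvdIn M b x}

/-- `M` satisfies the ascending chain condition on principal ideals. -/
def ACCPIn (M : AddSubmonoid ℚ) : Prop :=
  ∀ b : ℕ → ℚ, (∀ n, b n ∈ M) →
    (∀ n, PIdealIn M (b n) ⊆ PIdealIn M (b (n + 1))) →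
    ∃ N, ∀ n, N ≤ n → PIdealIn M (b n) = PIdealIn M (b N)

/-- `a` is an atom (irreducible element) of `M`: a non-invertible element of `M` such that
whenever `a = b + c` with `b, c ∈ M`, either `b` or `c` is invertible in `M`. -/
def IsAtomIn (M : AddSubmonoid ℚ) (a : ℚ) : Prop :=
  a ∈ M ∧ ¬ IsUnitIn M a ∧
    ∀ b ∈ M, ∀ c ∈ M, a = b + c → IsUnitIn M b ∨ IsUnitIn M c

/-- `M` is atomic: every non-invertible element of `M` is a finite sum of atoms of `M`. -/
def AtomicIn (M : AddSubmonoid ℚ) : Prop :=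
  ∀ x ∈ M, ¬ IsUnitIn M x →
    ∃ (k : ℕ) (f : Fin k → ℚ), (∀ i, IsAtomIn M (f i)) ∧ x = ∑ i, f i

/-- An additive submonoid of the nonnegative rationals is reduced. -/
theorem isUnitIn_iff_eq_zero {M : AddSubmonoid ℚ} (hM : ∀ x ∈ M, 0 ≤ x) {x : ℚ} :
    IsUnitIn M x ↔ x = 0 := by
  constructor
  · rintro ⟨hx, y, hy, h⟩
    linarith [hM x hx, hM y hy]
  · rintro rfl
    exact ⟨M.zero_mem, 0, M.zero_mem, add_zero 0⟩

/-- In a reduced monoid, every atom belongs to any given generating set. -/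
theorem IsAtomIn.mem_of_closure {S : Set ℚ} (hS : ∀ x ∈ AddSubmonoid.closure S, 0 ≤ x) {a : ℚ}
    (ha : IsAtomIn (AddSubmonoid.closure S) a) : a ∈ S := by
  have key : ∀ x ∈ AddSubmonoid.closure S, IsAtomIn (AddSubmonoid.closure S) x → x ∈ S := by
    intro x hx
    induction hx using AddSubmonoid.closure_induction with
    | mem x hx => exact fun _ => hx
    | zero => exact fun h => absurd ((isUnitIn_iff_eq_zero hS).2 rfl) h.2.1
    | add x y hx hy ihx ihy =>
      intro h
      rcases h.2.2 x hx y hy rfl with h0 | h0 <;> rw [isUnitIn_iff_eq_zero hS] at h0 <;> subst h0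
      · rw [zero_add] at h ⊢
        exact ihy h
      · rw [add_zero] at h ⊢
        exact ihx h
  exact key a ha.1 ha

/-- A monoid generated by atoms is atomic. -/
theorem atomicIn_closure {S : Set ℚ} (hS : ∀ a ∈ S, IsAtomIn (AddSubmonoid.closure S) a) :
    AtomicIn (AddSubmonoid.closure S) := by
  intro x hx _
  obtain ⟨l, hl, rfl⟩ := AddSubmonoid.exists_list_of_mem_closure hx
  exact ⟨l.length, fun i => l[i], fun i => hS _ (hl _ (l.getElem_mem i.2)),
    (Fin.sum_univ_getElem l).symm⟩

/-- If every generator other than `a` is `p`-integral while `a` is not, then `a` is an atom. -/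
theorem isAtomIn_closure_of_padicNorm {S : Set ℚ} (hS : ∀ x ∈ AddSubmonoid.closure S, 0 ≤ x)
    (p : ℕ) [Fact p.Prime] {a : ℚ} (ha : a ∈ S) (hap : 1 < padicNorm p a)
    (hp : ∀ x ∈ S, x ≠ a → padicNorm p x ≤ 1) :
    IsAtomIn (AddSubmonoid.closure S) a := by
  have key : ∀ x ∈ AddSubmonoid.closure S, padicNorm p x ≤ 1 ∨ a ≤ x := by
    intro x hx
    induction hx using AddSubmonoid.closure_induction with
    | mem x hx =>
      by_cases h : x = a
      · exact Or.inr h.ge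
      · exact Or.inl (hp x hx h)
    | zero => simp
    | add x y hx hy ihx ihy =>
      have hx0 := hS x hx
      have hy0 := hS y hy
      rcases ihx with h | h
      · rcases ihy with h' | h'
        · exact Or.inl (padicNorm.nonarchimedean.trans (max_le h h'))
        · exact Or.inr (by linarith)
      · exact Or.inr (by linarith)
  refine ⟨AddSubmonoid.subset_closure ha, ?_, ?_⟩
  · rw [isUnitIn_iff_eq_zero hS]
    rintro rfl
    simp at hap
    linarith
  · intro b hb c hc h
    rw [isUnitIn_iff_eq_zero hS, isUnitIn_iff_eq_zero hS]
    have hb0 := hS b hb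
    have hc0 := hS c hc
    rcases key b hb with hb' | hb'
    · rcases key c hc with hc' | hc'
      · rw [h] at hap
        exact absurd (padicNorm.nonarchimedean.trans (max_le hb' hc')) hap.not_ge
      · exact Or.inl (by linarith)
    · exact Or.inr (by linarith)

/-- Let `(dₙ)` be a strictly increasing sequence of positive integers and `(pₙ)` a
sequence of pairwise distinct primes with `pₙ ∤ dₘ` for all `m, n`. Then the Grams-like
monoid `M = ⟨1/(dₙ pₙ) : n⟩` is atomic with set of atoms `{1/(dₙ pₙ) : n}`. -/
theorem gramsLike_atomic (d p : ℕ → ℕ)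
    (hdpos : ∀ n, 0 < d n) (hdmono : StrictMono d)
    (hp : ∀ n, Nat.Prime (p n)) (hpinj : Function.Injective p)
    (hpd : ∀ m n, ¬ p n ∣ d m)
    (M : AddSubmonoid ℚ)
    (hM : M = AddSubmonoid.closure {q : ℚ | ∃ n : ℕ, q = 1 / ((d n : ℚ) * (p n : ℚ))}) :
    AtomicIn M ∧
      {a : ℚ | IsAtomIn M a} = {q : ℚ | ∃ n : ℕ, q = 1 / ((d n : ℚ) * (p n : ℚ))} := by
  subst hM
  have hS : ∀ x ∈ AddSubmonoid.closure {q : ℚ | ∃ n : ℕ, q = 1 / ((d n : ℚ) * (p n : ℚ))},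
      0 ≤ x := by
    intro x hx
    induction hx using AddSubmonoid.closure_induction with
    | mem x hx =>
      obtain ⟨n, rfl⟩ := hx
      positivity
    | zero => exact le_rfl
    | add x y _ _ hx hy => exact add_nonneg hx hy
  have hatom : ∀ a ∈ {q : ℚ | ∃ n : ℕ, q = 1 / ((d n : ℚ) * (p n : ℚ))},
      IsAtomIn (AddSubmonoid.closure {q : ℚ | ∃ n : ℕ, q = 1 / ((d n : ℚ) * (p n : ℚ))}) a := by
    rintro _ ⟨n, rfl⟩
    have : Fact (p n).Prime := ⟨hp n⟩
    have hd : ∀ m, padicNorm (p n) (d m : ℚ) = 1 := fun m =>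
      (padicNorm.nat_eq_one_iff _).2 (hpd m n)
    refine isAtomIn_closure_of_padicNorm hS (p n) ⟨n, rfl⟩ ?_ ?_
    · rw [padicNorm.div, padicNorm.mul, hd, padicNorm.padicNorm_p_of_prime]
      simpa using (hp n).one_lt
    · rintro _ ⟨m, rfl⟩ hm
      have hpm : padicNorm (p n) (p m : ℚ) = 1 := by
        rw [padicNorm.nat_eq_one_iff, Nat.prime_dvd_prime_iff_eq (hp n) (hp m)]
        intro h
        exact hm (by rw [hpinj h])
      rw [padicNorm.div, padicNorm.mul, hd, hpm]
      simp
  exact ⟨atomicIn_closure hatom, Set.Subset.antisymm (fun _ ha => ha.mem_of_closure hS) hatom⟩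
end

section
/- Let (d_n)_{n ≥ 1} be a strictly increasing sequence of positive integers and (p_n)_{n ≥ 1} a sequence of pairwise distinct primes such that p_n does not divide d_m for any m, n ∈ ℕ. Let M be the Puiseux monoid generated by {1/(d_n p_n) : n ∈ ℕ} and N the Puiseux monoid generated by {1/d_n : n ∈ ℕ}. If N is a valuation monoid, then M does not satisfy the ascending chain condition on principal ideals (ACCP); in particular, the ascending chain of principal ideals (1/d_n + M)_{n ≥ 1} does not stabilize. -/
/-- A submonoid of `ℚ` generated by nonnegative elements consists of nonnegative elements. -/
theorem closure_nonneg {S : Set ℚ} (hS : ∀ x ∈ S, 0 ≤ x) :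
    ∀ x ∈ AddSubmonoid.closure S, 0 ≤ x := fun _ hx =>
  (AddSubmonoid.closure_le (S := AddSubmonoid.nonneg ℚ)).2 hS hx

theorem le_of_dvdIn {M : AddSubmonoid ℚ} (hM : ∀ x ∈ M, 0 ≤ x) {b c : ℚ}
    (h : DvdIn M c b) : c ≤ b := by
  obtain ⟨e, he, rfl⟩ := h
  exact le_add_of_nonneg_right (hM e he)

theorem pIdealIn_subset_of_dvdIn {M : AddSubmonoid ℚ} {b c : ℚ} (h : DvdIn M c b) :
    PIdealIn M b ⊆ PIdealIn M c := by
  obtain ⟨e, he, rfl⟩ := h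
  rintro _ ⟨f, hf, rfl⟩
  exact ⟨e + f, M.add_mem he hf, add_assoc _ _ _⟩

/-- Let `(dₙ)` be a strictly increasing sequence of positive integers and `(pₙ)` a
sequence of pairwise distinct primes with `pₙ ∤ dₘ` for all `m, n`. If the Puiseux monoid
`N = ⟨1/dₙ : n⟩` is a valuation monoid, then the Grams-like monoid `M = ⟨1/(dₙ pₙ) : n⟩`
does not satisfy the ACCP; in particular, `1/dₙ ∈ M` for each `n` and the ascending chain
of principal ideals `(1/dₙ + M)_{n ≥ 1}` does not stabilize. -/
theorem gramsLike_not_accp (d p : ℕ → ℕ)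
    (hdpos : ∀ n, 0 < d n) (hdmono : StrictMono d)
    (hp : ∀ n, Nat.Prime (p n)) (hpinj : Function.Injective p)
    (hpd : ∀ m n, ¬ p n ∣ d m)
    (M N : AddSubmonoid ℚ)
    (hM : M = AddSubmonoid.closure {q : ℚ | ∃ n : ℕ, q = 1 / ((d n : ℚ) * (p n : ℚ))})
    (hN : N = AddSubmonoid.closure {q : ℚ | ∃ n : ℕ, q = 1 / (d n : ℚ)})
    (hval : ∀ b ∈ N, ∀ c ∈ N, DvdIn N b c ∨ DvdIn N c b) :
    ¬ ACCPIn M ∧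
      (∀ n : ℕ, (1 / (d n : ℚ)) ∈ M) ∧
      (∀ n : ℕ, PIdealIn M (1 / (d n : ℚ)) ⊆ PIdealIn M (1 / (d (n + 1) : ℚ))) ∧
      ¬ ∃ N₀ : ℕ, ∀ n : ℕ, N₀ ≤ n →
        PIdealIn M (1 / (d n : ℚ)) = PIdealIn M (1 / (d N₀ : ℚ)) := by
  have hd0 : ∀ n, (0 : ℚ) < d n := fun n => by exact_mod_cast hdpos n
  have hp0 : ∀ n, (p n : ℚ) ≠ 0 := fun n => by exact_mod_cast (hp n).ne_zero
  have hmem : ∀ n : ℕ, (1 / (d n : ℚ)) ∈ M := fun n => by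
    have hgen : 1 / ((d n : ℚ) * (p n : ℚ)) ∈ M :=
      hM ▸ AddSubmonoid.subset_closure ⟨n, rfl⟩
    have heq : 1 / (d n : ℚ) = p n • (1 / ((d n : ℚ) * (p n : ℚ))) := by
      have := (hd0 n).ne'
      have := hp0 n
      rw [nsmul_eq_mul]
      field_simp
    exact heq ▸ M.nsmul_mem hgen (p n)
  have hNM : N ≤ M := by
    rw [hN, AddSubmonoid.closure_le]
    rintro _ ⟨n, rfl⟩
    exact hmem n
  have hM0 : ∀ x ∈ M, 0 ≤ x := by
    rw [hM]
    refine closure_nonneg ?_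
    rintro _ ⟨n, rfl⟩
    positivity
  have hlt : ∀ n : ℕ, 1 / (d (n + 1) : ℚ) < 1 / (d n : ℚ) := fun n =>
    one_div_lt_one_div_of_lt (hd0 n) (by exact_mod_cast hdmono n.lt_succ_self)
  have hmemN : ∀ n : ℕ, (1 / (d n : ℚ)) ∈ N := fun n =>
    hN ▸ AddSubmonoid.subset_closure ⟨n, rfl⟩
  have hchain : ∀ n : ℕ,
      PIdealIn M (1 / (d n : ℚ)) ⊆ PIdealIn M (1 / (d (n + 1) : ℚ)) := fun n => by
    refine pIdealIn_subset_of_dvdIn ?_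
    rcases hval _ (hmemN (n + 1)) _ (hmemN n) with ⟨e, he, h⟩ | h
    · exact ⟨e, hNM he, h⟩
    · exact absurd (le_of_dvdIn (fun x hx => hM0 x (hNM hx)) h) (hlt n).not_ge
  have hstab : ¬ ∃ N₀ : ℕ, ∀ n : ℕ, N₀ ≤ n →
      PIdealIn M (1 / (d n : ℚ)) = PIdealIn M (1 / (d N₀ : ℚ)) := by
    rintro ⟨k, hk⟩
    have hself : 1 / (d (k + 1) : ℚ) ∈ PIdealIn M (1 / (d (k + 1) : ℚ)) :=
      ⟨0, M.zero_mem, (add_zero _).symm⟩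
    rw [hk (k + 1) k.le_succ] at hself
    exact (hlt k).not_ge (le_of_dvdIn hM0 hself)
  exact ⟨fun h => hstab (h _ hmem hchain), hmem, hchain, hstab⟩
end

section
/- Let (d_n)_{n ≥ 1} be a strictly increasing sequence of positive integers and (p_n)_{n ≥ 1} a sequence of pairwise distinct primes such that p_n does not divide d_m for any m, n ∈ ℕ. Let M be the Puiseux monoid generated by {1/(d_n p_n) : n ∈ ℕ} and N the Puiseux monoid generated by {1/d_n : n ∈ ℕ}. Suppose q_1, q_2 ∈ M with q_1 dividing q_2 in M, and write q_i = c_0(q_i) + Σ_{n ∈ ℕ} c_n(q_i)·1/(d_n p_n) for i = 1, 2, where c_0(q_i) ∈ N and each c_n(q_i) is an integer in {0, 1, ..., p_n − 1} with only finitely many nonzero. Then: (1) c_0(q_1) divides c_0(q_2) in N; and (2) if c_0(q_1) = c_0(q_2), then c_n(q_1) ≤ c_n(q_2) for every n ∈ ℕ. -/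
/-- `(c₀, c)` is a canonical sum decomposition of `q`: `q = c₀ + Σₙ cₙ · 1/(dₙ pₙ)` with
`c₀ ∈ N`, each `cₙ ∈ {0, 1, ..., pₙ - 1}`, and only finitely many `cₙ` nonzero. -/
def IsCanonDecomp (d p : ℕ → ℕ) (N : AddSubmonoid ℚ) (q c0 : ℚ) (c : ℕ → ℕ) : Prop :=
  c0 ∈ N ∧ (∀ n, c n < p n) ∧ {n | c n ≠ 0}.Finite ∧
    q = c0 + ∑ᶠ n : ℕ, (c n : ℚ) * (1 / ((d n : ℚ) * (p n : ℚ)))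

theorem exists_finsupp_of_mem_closure (w : ℕ → ℚ) {x : ℚ}
    (hx : x ∈ AddSubmonoid.closure {q : ℚ | ∃ n : ℕ, q = w n}) :
    ∃ c : ℕ →₀ ℕ, x = c.sum fun n k => (k : ℚ) * w n := by
  induction hx using AddSubmonoid.closure_induction with
  | mem x hx =>
    obtain ⟨n, rfl⟩ := hx
    exact ⟨Finsupp.single n 1, by simp⟩
  | zero => exact ⟨0, by simp⟩
  | add x y _ _ hx hy =>
    obtain ⟨c, rfl⟩ := hx
    obtain ⟨e, rfl⟩ := hy
    refine ⟨c + e, (Finsupp.sum_add_index' ?_ ?_).symm⟩ <;> intros <;> simp [add_mul]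

/-- The `p`-adic norm of a natural number prime to `p` is one. -/
theorem padicNorm_natCast_eq_one {p m : ℕ} [Fact p.Prime] (h : ¬ p ∣ m) :
    padicNorm p (m : ℚ) = 1 :=
  padicNorm.nat_eq_one_iff m |>.2 h

theorem padicNorm_le_one_of_mem_closure {p : ℕ} [Fact p.Prime] {d : ℕ → ℕ}
    (hpd : ∀ m, ¬ p ∣ d m) {x : ℚ}
    (hx : x ∈ AddSubmonoid.closure {q : ℚ | ∃ n : ℕ, q = 1 / (d n : ℚ)}) :
    padicNorm p x ≤ 1 := by
  induction hx using AddSubmonoid.closure_induction with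
  | mem x hx =>
    obtain ⟨n, rfl⟩ := hx
    rw [padicNorm.div, padicNorm_natCast_eq_one (hpd n)]
    simp
  | zero => simp
  | add x y _ _ hx hy => exact padicNorm.nonarchimedean.trans (max_le hx hy)

/-- If a finite sum `∑ zₙ / (dₙ pₙ)` is `pₘ`-integral, then `pₘ` divides `zₘ`. -/
theorem dvd_of_padicNorm_sum_le_one {d p : ℕ → ℕ} (hp : ∀ n, Nat.Prime (p n))
    (hpinj : Function.Injective p) (hpd : ∀ m n, ¬ p n ∣ d m)
    {S : Finset ℕ} {z : ℕ → ℤ} {m : ℕ} (hm : m ∈ S)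
    (h : padicNorm (p m) (∑ n ∈ S, (z n : ℚ) * (1 / ((d n : ℚ) * (p n : ℚ)))) ≤ 1) :
    (p m : ℤ) ∣ z m := by
  have : Fact (p m).Prime := ⟨hp m⟩
  have hrest : padicNorm (p m)
      (∑ n ∈ S.erase m, (z n : ℚ) * (1 / ((d n : ℚ) * (p n : ℚ)))) ≤ 1 := by
    refine padicNorm.sum_le' (fun n hn => ?_) zero_le_one
    have hne : ¬ p m ∣ p n := fun hdiv =>
      Finset.ne_of_mem_erase hn (hpinj ((Nat.prime_dvd_prime_iff_eq (hp m) (hp n)).1 hdiv)).symm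
    rw [padicNorm.mul, padicNorm.div, padicNorm.mul, padicNorm_natCast_eq_one (hpd n m),
      padicNorm_natCast_eq_one hne]
    simpa using padicNorm.of_int (p := p m) (z n)
  have hterm : padicNorm (p m) ((z m : ℚ) * (1 / ((d m : ℚ) * (p m : ℚ)))) ≤ 1 := by
    have heq := Finset.add_sum_erase S (fun n => (z n : ℚ) * (1 / ((d n : ℚ) * (p n : ℚ)))) hm
    rw [eq_sub_of_add_eq heq]
    exact padicNorm.sub.trans (max_le h hrest)
  have hpos : (0 : ℚ) < p m := by exact_mod_cast (hp m).pos
  rw [padicNorm.mul, padicNorm.div, padicNorm.mul, padicNorm_natCast_eq_one (hpd m m),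
    padicNorm.padicNorm_p_of_prime] at hterm
  have := (padicNorm.dvd_iff_norm_le (p := p m) (n := 1) (z := z m)).2 (by
    simp only [padicNorm.one, one_mul, one_div, inv_inv] at hterm
    rw [← le_div_iff₀ hpos] at hterm
    simpa [zpow_neg] using hterm)
  simpa using this

/-- With `M = ⟨1/(dₙ pₙ) : n⟩` and `N = ⟨1/dₙ : n⟩` as in the Grams-like construction,
suppose `q₁ ∣ q₂` in `M` and that `(a0, a)` and `(b0, b)` are the canonical sum
decompositions of `q₁` and `q₂`, respectively. Then `a0 ∣ b0` in `N`, and if `a0 = b0`,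
then `aₙ ≤ bₙ` for every `n`. -/
theorem gramsLike_canonical_decomposition_of_dvd (d p : ℕ → ℕ)
    (hdpos : ∀ n, 0 < d n) (hdmono : StrictMono d)
    (hp : ∀ n, Nat.Prime (p n)) (hpinj : Function.Injective p)
    (hpd : ∀ m n, ¬ p n ∣ d m)
    (M N : AddSubmonoid ℚ)
    (hM : M = AddSubmonoid.closure {q : ℚ | ∃ n : ℕ, q = 1 / ((d n : ℚ) * (p n : ℚ))})
    (hN : N = AddSubmonoid.closure {q : ℚ | ∃ n : ℕ, q = 1 / (d n : ℚ)})
    (q1 q2 : ℚ) (hq1 : q1 ∈ M) (hq2 : q2 ∈ M) (hdvd : DvdIn M q1 q2)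
    (a0 b0 : ℚ) (a b : ℕ → ℕ)
    (ha : IsCanonDecomp d p N q1 a0 a) (hb : IsCanonDecomp d p N q2 b0 b) :
    DvdIn N a0 b0 ∧ (a0 = b0 → ∀ n, a n ≤ b n) := by
  obtain ⟨e, he, hq⟩ := hdvd
  obtain ⟨ha0, -, hafin, ha⟩ := ha
  obtain ⟨hb0, hbp, hbfin, hb⟩ := hb
  rw [hM] at he
  obtain ⟨c, hc⟩ := exists_finsupp_of_mem_closure _ he
  set S : Finset ℕ := hafin.toFinset ∪ hbfin.toFinset ∪ c.support with hS
  have haS : ∀ n, n ∉ S → a n = 0 := fun n hn => by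
    by_contra h; exact hn (by simp [hS, h])
  have hbS : ∀ n, n ∉ S → b n = 0 := fun n hn => by
    by_contra h; exact hn (by simp [hS, h])
  rw [finsum_eq_sum_of_support_subset (s := S) _ (by
    intro n hn; by_contra h; exact hn (by simp [haS n h]))] at ha
  rw [finsum_eq_sum_of_support_subset (s := S) _ (by
    intro n hn; by_contra h; exact hn (by simp [hbS n h]))] at hb
  rw [Finsupp.sum_of_support_subset c (s := S) Finset.subset_union_right _ (by simp)] at hc
  have hsum : b0 - a0 =
      ∑ n ∈ S, (((a n + c n - b n : ℤ)) : ℚ) * (1 / ((d n : ℚ) * (p n : ℚ))) := by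
    push_cast
    simp only [sub_mul, add_mul, Finset.sum_sub_distrib, Finset.sum_add_distrib]
    linarith
  have hdiv : ∀ n ∈ S, ∃ k : ℕ, (a n + c n - b n : ℤ) = p n * k := by
    intro n hn
    have : Fact (p n).Prime := ⟨hp n⟩
    obtain ⟨k, hk⟩ := dvd_of_padicNorm_sum_le_one hp hpinj hpd
      (z := fun n => (a n + c n - b n : ℤ)) hn (by
        rw [← hsum]
        exact padicNorm.sub.trans (max_le
          (padicNorm_le_one_of_mem_closure (hpd · n) (hN ▸ hb0))
          (padicNorm_le_one_of_mem_closure (hpd · n) (hN ▸ ha0))))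
    have hk0 : 0 ≤ k := by
      by_contra! hneg
      have := hbp n
      have : (p n : ℤ) * k ≤ p n * (-1) :=
        mul_le_mul_of_nonneg_left (by omega) (by omega)
      omega
    lift k to ℕ using hk0
    exact ⟨k, hk⟩
  choose! k hk using hdiv
  have hsum' : b0 - a0 = ∑ n ∈ S, (k n : ℚ) * (1 / (d n : ℚ)) := by
    rw [hsum]
    refine Finset.sum_congr rfl fun n hn => ?_
    have hp0 : (p n : ℚ) ≠ 0 := by exact_mod_cast (hp n).ne_zero
    have hd0 : (d n : ℚ) ≠ 0 := by exact_mod_cast (hdpos n).ne'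
    rw [hk n hn]
    push_cast
    field_simp
  refine ⟨⟨b0 - a0, ?_, by ring⟩, fun hab n => ?_⟩
  · rw [hsum', hN]
    refine AddSubmonoid.sum_mem _ fun n _ => ?_
    rw [← nsmul_eq_mul]
    refine AddSubmonoid.nsmul_mem _ (AddSubmonoid.subset_closure ?_) _
    exact ⟨n, rfl⟩
  · by_cases hn : n ∈ S
    · have hd0 : (d n : ℚ) ≠ 0 := by exact_mod_cast (hdpos n).ne'
      rw [hab, sub_self, eq_comm, Finset.sum_eq_zero_iff_of_nonneg (fun _ _ => by positivity)]
        at hsum'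
      have hkn : k n = 0 := by simpa [hd0] using hsum' n hn
      have := hk n hn
      rw [hkn] at this
      push_cast at this
      omega
    · simp [haS n hn]
end

section
/- Let (d_n)_{n ≥ 1} be a strictly increasing sequence of positive integers and (p_n)_{n ≥ 1} a sequence of pairwise distinct primes such that p_n does not divide d_m for any m, n ∈ ℕ. Let M be the Puiseux monoid generated by {1/(d_n p_n) : n ∈ ℕ} and N the Puiseux monoid generated by {1/d_n : n ∈ ℕ}. Then M is MCD-finite if and only if N is MCD-finite. -/
/-- `M` is MCD-finite: every nonempty finite subset of `M` has only finitely many maximal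
common divisors (Puiseux monoids are reduced, so associates coincide). -/
def MCDFiniteIn (M : AddSubmonoid ℚ) : Prop :=
  ∀ S : Set ℚ, S.Finite → S.Nonempty → S ⊆ (M : Set ℚ) → {x : ℚ | IsMCDIn M x S}.Finite

open Finsupp in
/-- An additive monoid generated by a sequence consists of the linear combinations with
nonnegative integer coefficients. -/
lemma mem_closure_iff_linearCombination (g : ℕ → ℚ) (x : ℚ) :
    x ∈ AddSubmonoid.closure {q : ℚ | ∃ n, q = g n} ↔
      ∃ c : ℕ →₀ ℤ, 0 ≤ c ∧ linearCombination ℤ g c = x := by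
  constructor
  · intro hx
    induction hx using AddSubmonoid.closure_induction with
    | mem x hx =>
      obtain ⟨n, rfl⟩ := hx
      exact ⟨single n 1, single_nonneg.2 zero_le_one, by simp⟩
    | zero => exact ⟨0, le_rfl, by simp⟩
    | add x y _ _ hx hy =>
      obtain ⟨c, hc, rfl⟩ := hx
      obtain ⟨c', hc', rfl⟩ := hy
      exact ⟨c + c', add_nonneg hc hc', map_add _ _ _⟩
  · rintro ⟨c, hc, rfl⟩
    rw [linearCombination_apply]
    refine AddSubmonoid.sum_mem _ fun n _ => ?_
    obtain ⟨k, hk⟩ := Int.eq_ofNat_of_zero_le (hc n)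
    simp only [hk, natCast_zsmul]
    refine AddSubmonoid.nsmul_mem _ (AddSubmonoid.subset_closure ?_) k
    exact ⟨n, rfl⟩

/-- The integer combination of the reciprocals `1 / d n`. -/
noncomputable def denomSum (d : ℕ → ℕ) : (ℕ →₀ ℤ) →ₗ[ℤ] ℚ :=
  Finsupp.linearCombination ℤ fun n => 1 / (d n : ℚ)

/-- The integer combination of the reciprocals `1 / (d n * p n)`. -/
noncomputable def gramsSum (d p : ℕ → ℕ) : (ℕ →₀ ℤ) →ₗ[ℤ] ℚ :=
  Finsupp.linearCombination ℤ fun n => 1 / ((d n : ℚ) * (p n : ℚ))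

/-- Multiplication of the `n`-th coefficient by `p n`. -/
noncomputable def scaleCoeff (p : ℕ → ℕ) : (ℕ →₀ ℤ) →ₗ[ℤ] (ℕ →₀ ℤ) :=
  Finsupp.linearCombination ℤ fun n => Finsupp.single n (p n : ℤ)

/-- The coefficients at which a borrow occurs when subtracting `c'` from `c`. -/
noncomputable def borrow (c c' : ℕ →₀ ℤ) : ℕ →₀ ℤ :=
  Finsupp.zipWith (fun a b => if a < b then 1 else 0) (by simp) c c'

/-- Every coefficient `c n` is a canonical residue modulo `p n`. -/
def IsReducedModulo (p : ℕ → ℕ) (c : ℕ →₀ ℤ) : Prop := ∀ n, 0 ≤ c n ∧ c n < p n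

lemma scaleCoeff_apply (p : ℕ → ℕ) (c : ℕ →₀ ℤ) (n : ℕ) :
    scaleCoeff p c n = p n * c n := by
  induction c using Finsupp.induction_linear with
  | zero => simp
  | add f g hf hg => simp [hf, hg, mul_add]
  | single m k =>
    by_cases h : m = n
    · subst h; simp [scaleCoeff, mul_comm]
    · simp [scaleCoeff, h]

lemma borrow_apply (c c' : ℕ →₀ ℤ) (n : ℕ) :
    borrow c c' n = if c n < c' n then 1 else 0 := rfl

lemma borrow_nonneg (c c' : ℕ →₀ ℤ) : 0 ≤ borrow c c' := fun n => by
  rw [borrow_apply]; split_ifs <;> simp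

lemma isReducedModulo_sub_add_borrow {p : ℕ → ℕ} {c c' : ℕ →₀ ℤ} (hc : IsReducedModulo p c)
    (hc' : IsReducedModulo p c') : IsReducedModulo p (c - c' + scaleCoeff p (borrow c c')) :=
  fun n => by
    have h := hc n
    have h' := hc' n
    simp only [Finsupp.add_apply, Finsupp.sub_apply, scaleCoeff_apply, borrow_apply]
    split_ifs <;> constructor <;> linarith

lemma gramsSum_scaleCoeff {d p : ℕ → ℕ} (hp : ∀ n, (p n).Prime) (c : ℕ →₀ ℤ) :
    gramsSum d p (scaleCoeff p c) = denomSum d c := by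
  induction c using Finsupp.induction_linear with
  | zero => simp
  | add f g hf hg => simp [hf, hg]
  | single n k =>
    have : (p n : ℚ) ≠ 0 := by exact_mod_cast (hp n).ne_zero
    simp only [scaleCoeff, gramsSum, denomSum, Finsupp.linearCombination_single,
      Finsupp.smul_single, smul_eq_mul, zsmul_eq_mul, Int.cast_mul, Int.cast_natCast]
    field_simp

/-- The coefficient of `1 / (d n * p n)` is determined modulo `p n`. -/
lemma dvd_coeff_of_add_eq_zero {d p : ℕ → ℕ} (hp : ∀ n, (p n).Prime)
    (hpinj : Function.Injective p) (hpd : ∀ m n, ¬ p n ∣ d m) {a c : ℕ →₀ ℤ}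
    (h : denomSum d a + gramsSum d p c = 0) (n : ℕ) : (p n : ℤ) ∣ c n := by
  have : Fact (p n).Prime := ⟨hp n⟩
  have hdn (m : ℕ) : padicNorm (p n) (d m) = 1 := (padicNorm.nat_eq_one_iff _).2 (hpd m n)
  let A : AddSubgroup ℚ :=
    { carrier := {q | padicNorm (p n) q ≤ 1}
      zero_mem' := by simp
      add_mem' := fun {x y} hx hy => (padicNorm.nonarchimedean).trans (max_le hx hy)
      neg_mem' := fun {x} hx => by simpa using hx }
  have ha : denomSum d a ∈ A := by
    rw [denomSum, Finsupp.linearCombination_apply]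
    refine A.sum_mem fun m _ => A.zsmul_mem ?_ _
    change padicNorm _ _ ≤ 1
    rw [padicNorm.div, hdn, padicNorm.one, div_one]
  have hc : gramsSum d p (c - Finsupp.single n (c n)) ∈ A := by
    rw [gramsSum, Finsupp.linearCombination_apply]
    refine A.sum_mem fun m _ => ?_
    by_cases hm : m = n
    · simp [hm, A.zero_mem]
    · refine A.zsmul_mem ?_ _
      have : padicNorm (p n) (p m) = 1 := (padicNorm.nat_eq_one_iff _).2 fun hdvd =>
        hm (hpinj ((Nat.prime_dvd_prime_iff_eq (hp n) (hp m)).1 hdvd).symm)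
      change padicNorm _ _ ≤ 1
      rw [padicNorm.div, padicNorm.mul, hdn, this, padicNorm.one, one_mul, div_one]
  have hmem : gramsSum d p (Finsupp.single n (c n)) ∈ A := by
    have heq : gramsSum d p (Finsupp.single n (c n)) =
        -(denomSum d a + gramsSum d p (c - Finsupp.single n (c n))) := by
      rw [map_sub]; linarith
    rw [heq]
    exact A.neg_mem (A.add_mem ha hc)
  have hle : padicNorm (p n) (c n * (1 / ((d n : ℚ) * (p n : ℚ)))) ≤ 1 := by
    rw [gramsSum, Finsupp.linearCombination_single, zsmul_eq_mul] at hmem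
    exact hmem
  have hpos : (0 : ℚ) < p n := by exact_mod_cast (hp n).pos
  have := (padicNorm.dvd_iff_norm_le (p := p n) (n := 1) (z := c n)).2 (by
    rw [padicNorm.mul, padicNorm.div, padicNorm.mul, hdn, padicNorm.padicNorm_p_of_prime] at hle
    simp only [padicNorm.one, one_mul, one_div, inv_inv] at hle
    simp only [Nat.cast_one, zpow_neg, zpow_one]
    rwa [← le_div_iff₀ hpos, one_div] at hle)
  simpa using this

lemma exists_reduced {d p : ℕ → ℕ} (hp : ∀ n, (p n).Prime) {x : ℚ}
    (hx : ∃ c : ℕ →₀ ℤ, 0 ≤ c ∧ gramsSum d p c = x) :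
    ∃ a c : ℕ →₀ ℤ, 0 ≤ a ∧ IsReducedModulo p c ∧ denomSum d a + gramsSum d p c = x := by
  obtain ⟨c, hc, rfl⟩ := hx
  let a : ℕ →₀ ℤ := Finsupp.onFinset c.support (fun n => c n / p n) fun n hn => by
    rw [Finsupp.mem_support_iff]
    rintro h
    simp [h] at hn
  have ha (n : ℕ) : a n = c n / p n := rfl
  have hpos (n : ℕ) : (0 : ℤ) < p n := by exact_mod_cast (hp n).pos
  refine ⟨a, c - scaleCoeff p a, fun n => Int.ediv_nonneg (hc n) (hpos n).le, fun n => ?_, ?_⟩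
  · rw [Finsupp.sub_apply, scaleCoeff_apply, ha, ← Int.emod_def]
    exact ⟨Int.emod_nonneg _ (hpos n).ne', Int.emod_lt_of_pos _ (hpos n)⟩
  · rw [map_sub, gramsSum_scaleCoeff hp, add_sub_cancel]

/-- Membership in the Grams-like monoid is detected by the part without the primes `p n`,
once the remaining coefficients have been normalised by the carries `b`. -/
lemma add_gramsSum_mem_iff {d p : ℕ → ℕ} (hp : ∀ n, (p n).Prime)
    (hpinj : Function.Injective p) (hpd : ∀ m n, ¬ p n ∣ d m) {M N : AddSubmonoid ℚ}
    (hM : ∀ x, x ∈ M ↔ ∃ c : ℕ →₀ ℤ, 0 ≤ c ∧ gramsSum d p c = x)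
    (hN : ∀ x, x ∈ N ↔ ∃ c : ℕ →₀ ℤ, 0 ≤ c ∧ denomSum d c = x) {a b c : ℕ →₀ ℤ}
    (h : IsReducedModulo p (c + scaleCoeff p b)) :
    denomSum d a + gramsSum d p c ∈ M ↔ denomSum d a - denomSum d b ∈ N := by
  have key : gramsSum d p c = gramsSum d p (c + scaleCoeff p b) - denomSum d b := by
    rw [map_add, gramsSum_scaleCoeff hp, add_sub_cancel_right]
  constructor
  · intro hx
    obtain ⟨a', c', ha', hc', hx'⟩ := exists_reduced hp ((hM _).1 hx)
    have h0 : denomSum d (a' - a + b) + gramsSum d p (c' - (c + scaleCoeff p b)) = 0 := by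
      rw [map_sub, map_add, map_sub]; linarith
    have hcc : c' = c + scaleCoeff p b := by
      ext n
      have hdvd := dvd_coeff_of_add_eq_zero hp hpinj hpd h0 n
      rw [Finsupp.sub_apply] at hdvd
      have h1 := hc' n
      have h2 := h n
      have := Int.eq_zero_of_abs_lt_dvd hdvd (abs_lt.2 ⟨by linarith, by linarith⟩)
      linarith
    refine (hN _).2 ⟨a', ha', ?_⟩
    rw [hcc] at hx'
    linarith
  · intro hx
    obtain ⟨a', ha', hx'⟩ := (hN _).1 hx
    refine (hM _).2 ⟨scaleCoeff p a' + (c + scaleCoeff p b), fun n => ?_, ?_⟩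
    · have h1 := (h n).1
      have h2 : 0 ≤ (p n : ℤ) * a' n := mul_nonneg (by positivity) (ha' n)
      rw [Finsupp.add_apply, scaleCoeff_apply]
      exact add_nonneg h2 h1
    · rw [map_add, gramsSum_scaleCoeff hp]
      linarith

lemma nonneg_of_mem_gramsLike {d p : ℕ → ℕ} {M : AddSubmonoid ℚ}
    (hM : ∀ x, x ∈ M ↔ ∃ c : ℕ →₀ ℤ, 0 ≤ c ∧ gramsSum d p c = x) {x : ℚ} (hx : x ∈ M) :
    0 ≤ x := by
  obtain ⟨c, hc, rfl⟩ := (hM x).1 hx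
  rw [gramsSum, Finsupp.linearCombination_apply]
  exact Finset.sum_nonneg fun n _ => zsmul_nonneg (by positivity) (hc n)

lemma dvdIn_iff {M : AddSubmonoid ℚ} {c b : ℚ} : DvdIn M c b ↔ b - c ∈ M :=
  ⟨fun ⟨d, hd, h⟩ => by rwa [h, add_sub_cancel_left], fun h => ⟨_, h, by ring⟩⟩

/-- In an MCD-finite monoid, finiteness also holds for sets not contained in the monoid. -/
lemma MCDFiniteIn.finite {M : AddSubmonoid ℚ} (h : MCDFiniteIn M) {S : Set ℚ} (hS : S.Finite)
    (hne : S.Nonempty) : {x : ℚ | IsMCDIn M x S}.Finite := by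
  by_cases hSM : S ⊆ (M : Set ℚ)
  · exact h S hS hne hSM
  · convert Set.finite_empty
    refine Set.eq_empty_of_forall_notMem fun x hx => hSM fun s hs => ?_
    obtain ⟨e, he, rfl⟩ := hx.2.1 s hs
    exact M.add_mem hx.1 he

lemma isReducedModulo_zero {p : ℕ → ℕ} (hp : ∀ n, (p n).Prime) : IsReducedModulo p 0 :=
  fun n => by
    simpa using (hp n).pos

/-- Maximal common divisors in the monoid generated by the `1 / d n` remain maximal common
divisors in the Grams-like monoid. -/
lemma IsMCDIn.gramsLike {d p : ℕ → ℕ} (hp : ∀ n, (p n).Prime)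
    (hpinj : Function.Injective p) (hpd : ∀ m n, ¬ p n ∣ d m) {M N : AddSubmonoid ℚ}
    (hM : ∀ x, x ∈ M ↔ ∃ c : ℕ →₀ ℤ, 0 ≤ c ∧ gramsSum d p c = x)
    (hN : ∀ x, x ∈ N ↔ ∃ c : ℕ →₀ ℤ, 0 ≤ c ∧ denomSum d c = x) (hNM : N ≤ M)
    {S : Set ℚ} (hSN : S ⊆ (N : Set ℚ)) {x : ℚ} (hx : IsMCDIn N x S) : IsMCDIn M x S := by
  refine ⟨hNM hx.1, fun s hs => (hx.2.1 s hs).imp fun _ h => ⟨hNM h.1, h.2⟩, fun e he hdvd => ?_⟩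
  refine ⟨he, ?_⟩
  obtain ⟨a, c, ha, hc, rfl⟩ := exists_reduced hp ((hM _).1 he)
  set b := borrow 0 c with hb
  have hred := isReducedModulo_sub_add_borrow (isReducedModulo_zero hp) hc
  rw [← hb] at hred
  have hunit := hx.2.2 (denomSum d (a + b))
    ((hN _).2 ⟨_, add_nonneg ha (borrow_nonneg _ _), rfl⟩) fun s hs => by
      obtain ⟨u, -, hu⟩ := (hN s).1 (hSN hs)
      obtain ⟨v, -, hv⟩ := (hN x).1 hx.1
      have h := dvdIn_iff.1 (hdvd s hs)
      have heq : s - x - (denomSum d a + gramsSum d p c) =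
          denomSum d (u - v - a) + gramsSum d p (0 - c) := by
        rw [map_sub, map_sub, map_sub, map_zero, hu, hv]; ring
      rw [heq, add_gramsSum_mem_iff hp hpinj hpd hM hN hred] at h
      rw [dvdIn_iff]
      convert h using 1
      rw [map_sub, map_sub, map_add, hu, hv]; ring
  obtain ⟨f, hf, h0⟩ := hunit.2
  refine ⟨gramsSum d p (0 - c + scaleCoeff p b) + f,
    M.add_mem ((hM _).2 ⟨_, fun n => (hred n).1, rfl⟩) (hNM hf), ?_⟩
  rw [map_add, gramsSum_scaleCoeff hp, map_sub, map_zero]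
  rw [map_add] at h0
  linarith

/-- The normal form of a maximal common divisor in the Grams-like monoid has no coefficient
outside the supports of the normal forms of the elements it divides. -/
lemma IsMCDIn.coeff_eq_zero {d p : ℕ → ℕ} (hdpos : ∀ n, 0 < d n) (hp : ∀ n, (p n).Prime)
    (hpinj : Function.Injective p) (hpd : ∀ m n, ¬ p n ∣ d m) {M N : AddSubmonoid ℚ}
    (hM : ∀ x, x ∈ M ↔ ∃ c : ℕ →₀ ℤ, 0 ≤ c ∧ gramsSum d p c = x)
    (hN : ∀ x, x ∈ N ↔ ∃ c : ℕ →₀ ℤ, 0 ≤ c ∧ denomSum d c = x)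
    {S : Set ℚ} {A C : ℚ → ℕ →₀ ℤ} (hC : ∀ s ∈ S, IsReducedModulo p (C s))
    (hAC : ∀ s ∈ S, denomSum d (A s) + gramsSum d p (C s) = s) {a c : ℕ →₀ ℤ}
    (hc : IsReducedModulo p c) (hx : IsMCDIn M (denomSum d a + gramsSum d p c) S) {n : ℕ}
    (hn : ∀ s ∈ S, C s n = 0) : c n = 0 := by
  by_contra hne
  have hcn : 0 < c n := lt_of_le_of_ne (hc n).1 (Ne.symm hne)
  set r := Finsupp.single n ((p n : ℤ) - c n) with hr
  have hrpos : 0 < (p n : ℤ) - c n := sub_pos.2 (hc n).2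
  have hunit := hx.2.2 (gramsSum d p r)
    ((hM _).2 ⟨_, Finsupp.single_nonneg.2 hrpos.le, rfl⟩) fun s hs => by
      have hred := isReducedModulo_sub_add_borrow (hC s hs) hc
      have hred' : IsReducedModulo p (C s - c - r + scaleCoeff p (borrow (C s) c)) := fun m => by
        by_cases hm : m = n
        · subst hm
          simp [hr, scaleCoeff_apply, borrow_apply, hn s hs, hcn, (hp m).pos]
          linarith
        · have := hred m
          simpa [hr, Finsupp.single_apply, Ne.symm hm] using this
      have h := dvdIn_iff.1 (hx.2.1 s hs)
      have heq : s - (denomSum d a + gramsSum d p c) =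
          denomSum d (A s - a) + gramsSum d p (C s - c) := by
        rw [map_sub, map_sub]; linarith [hAC s hs]
      have heq' : s - (denomSum d a + gramsSum d p c) - gramsSum d p r =
          denomSum d (A s - a) + gramsSum d p (C s - c - r) := by
        rw [map_sub _ _ r, heq]; ring
      rw [heq, add_gramsSum_mem_iff hp hpinj hpd hM hN hred] at h
      rwa [dvdIn_iff, heq', add_gramsSum_mem_iff hp hpinj hpd hM hN hred']
  obtain ⟨f, hf, h0⟩ := hunit.2
  have hf0 := nonneg_of_mem_gramsLike hM hf
  have hr0 : 0 < gramsSum d p r := by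
    rw [hr, gramsSum, Finsupp.linearCombination_single]
    refine zsmul_pos ?_ hrpos
    have h1 : (0 : ℚ) < d n := by exact_mod_cast hdpos n
    have h2 : (0 : ℚ) < p n := by exact_mod_cast (hp n).pos
    positivity
  linarith

/-- Subtracting the fixed fractional part from a maximal common divisor in the Grams-like
monoid yields a maximal common divisor in the monoid generated by the `1 / d n`. -/
lemma IsMCDIn.integralPart {d p : ℕ → ℕ} (hp : ∀ n, (p n).Prime)
    (hpinj : Function.Injective p) (hpd : ∀ m n, ¬ p n ∣ d m) {M N : AddSubmonoid ℚ}
    (hM : ∀ x, x ∈ M ↔ ∃ c : ℕ →₀ ℤ, 0 ≤ c ∧ gramsSum d p c = x)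
    (hN : ∀ x, x ∈ N ↔ ∃ c : ℕ →₀ ℤ, 0 ≤ c ∧ denomSum d c = x) (hNM : N ≤ M)
    {S : Set ℚ} {A C : ℚ → ℕ →₀ ℤ} (hC : ∀ s ∈ S, IsReducedModulo p (C s))
    (hAC : ∀ s ∈ S, denomSum d (A s) + gramsSum d p (C s) = s) {a c : ℕ →₀ ℤ}
    (ha : 0 ≤ a) (hc : IsReducedModulo p c)
    (hx : IsMCDIn M (denomSum d a + gramsSum d p c) S) :
    IsMCDIn N (denomSum d a) ((fun s => denomSum d (A s) - denomSum d (borrow (C s) c)) '' S) := by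
  have hred (s : ℚ) (hs : s ∈ S) := isReducedModulo_sub_add_borrow (hC s hs) hc
  refine ⟨(hN _).2 ⟨a, ha, rfl⟩, ?_, fun e he hdvd => ?_⟩
  · rintro _ ⟨s, hs, rfl⟩
    have h := dvdIn_iff.1 (hx.2.1 s hs)
    have heq : s - (denomSum d a + gramsSum d p c) =
        denomSum d (A s - a) + gramsSum d p (C s - c) := by
      rw [map_sub, map_sub]; linarith [hAC s hs]
    rw [heq, add_gramsSum_mem_iff hp hpinj hpd hM hN (hred s hs), map_sub] at h
    rw [dvdIn_iff]
    convert h using 1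
    ring
  · have hunit := hx.2.2 e (hNM he) fun s hs => by
      obtain ⟨k, -, rfl⟩ := (hN e).1 he
      have h := dvdIn_iff.1 (hdvd _ ⟨s, hs, rfl⟩)
      have heq : s - (denomSum d a + gramsSum d p c) - denomSum d k =
          denomSum d (A s - a - k) + gramsSum d p (C s - c) := by
        rw [map_sub, map_sub, map_sub]; linarith [hAC s hs]
      rw [dvdIn_iff, heq, add_gramsSum_mem_iff hp hpinj hpd hM hN (hred s hs), map_sub, map_sub]
      convert h using 1
      ring
    obtain ⟨f, hf, h0⟩ := hunit.2
    have he0 : e = 0 := by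
      linarith [nonneg_of_mem_gramsLike hM (hNM he), nonneg_of_mem_gramsLike hM hf]
    exact ⟨he, 0, N.zero_mem, by rw [he0, add_zero]⟩

/-- Let `(dₙ)` be a strictly increasing sequence of positive integers and `(pₙ)` a
sequence of pairwise distinct primes with `pₙ ∤ dₘ` for all `m, n`. Then the Grams-like
monoid `M = ⟨1/(dₙ pₙ) : n⟩` is MCD-finite if and only if `N = ⟨1/dₙ : n⟩` is
MCD-finite. -/
theorem gramsLike_mcdFinite_iff (d p : ℕ → ℕ)
    (hdpos : ∀ n, 0 < d n) (hdmono : StrictMono d)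
    (hp : ∀ n, Nat.Prime (p n)) (hpinj : Function.Injective p)
    (hpd : ∀ m n, ¬ p n ∣ d m)
    (M N : AddSubmonoid ℚ)
    (hM : M = AddSubmonoid.closure {q : ℚ | ∃ n : ℕ, q = 1 / ((d n : ℚ) * (p n : ℚ))})
    (hN : N = AddSubmonoid.closure {q : ℚ | ∃ n : ℕ, q = 1 / (d n : ℚ)}) :
    MCDFiniteIn M ↔ MCDFiniteIn N := by
  have hM' (x : ℚ) : x ∈ M ↔ ∃ c : ℕ →₀ ℤ, 0 ≤ c ∧ gramsSum d p c = x := by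
    rw [hM]; exact mem_closure_iff_linearCombination _ x
  have hN' (x : ℚ) : x ∈ N ↔ ∃ c : ℕ →₀ ℤ, 0 ≤ c ∧ denomSum d c = x := by
    rw [hN]; exact mem_closure_iff_linearCombination _ x
  have hNM : N ≤ M := fun x hx => by
    obtain ⟨c, hc, rfl⟩ := (hN' x).1 hx
    refine (hM' _).2 ⟨scaleCoeff p c, fun n => ?_, gramsSum_scaleCoeff hp c⟩
    rw [scaleCoeff_apply]
    exact mul_nonneg (by positivity) (hc n)
  constructor
  · intro h S hS hne hSN
    exact (h S hS hne (hSN.trans hNM)).subset fun x hx =>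
      hx.gramsLike hp hpinj hpd hM' hN' hNM hSN
  · intro h S hS hne hSM
    have hrep (s : ℚ) : ∃ ac : (ℕ →₀ ℤ) × (ℕ →₀ ℤ), s ∈ S →
        IsReducedModulo p ac.2 ∧ denomSum d ac.1 + gramsSum d p ac.2 = s := by
      by_cases hs : s ∈ S
      · obtain ⟨a, c, -, hac⟩ := exists_reduced hp ((hM' s).1 (hSM hs))
        exact ⟨(a, c), fun _ => hac⟩
      · exact ⟨0, fun h => absurd h hs⟩
    choose AC hAC using hrep
    let F : Finset ℕ := hS.toFinset.biUnion fun s => (AC s).2.support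
    let T (c : ℕ →₀ ℤ) : Set ℚ :=
      (fun s => denomSum d (AC s).1 - denomSum d (borrow (AC s).2 c)) '' S
    have hfin : (⋃ c ∈ F.finsupp fun n => Finset.Ico 0 (p n : ℤ),
        (· + gramsSum d p c) '' {y | IsMCDIn N y (T c)}).Finite :=
      (Finset.finite_toSet _).biUnion fun c _ => (h.finite (hS.image _) (hne.image _)).image _
    refine hfin.subset fun x hx => ?_
    obtain ⟨a, c, ha, hc, rfl⟩ := exists_reduced hp ((hM' x).1 hx.1)
    have hsupp : c.support ⊆ F := fun n hn => by
      by_contra hnF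
      refine Finsupp.mem_support_iff.1 hn (hx.coeff_eq_zero hdpos hp hpinj hpd hM' hN'
        (A := fun s => (AC s).1) (fun s hs => (hAC s hs).1) (fun s hs => (hAC s hs).2) hc
        fun s hs => ?_)
      by_contra hsn
      exact hnF (Finset.mem_biUnion.2
        ⟨s, hS.mem_toFinset.2 hs, Finsupp.mem_support_iff.2 hsn⟩)
    exact Set.mem_biUnion
      (Finset.mem_finsupp_iff.2 ⟨hsupp, fun n _ => Finset.mem_Ico.2 (hc n)⟩)
      ⟨denomSum d a, hx.integralPart hp hpinj hpd hM' hN' hNM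
        (A := fun s => (AC s).1) (fun s hs => (hAC s hs).1) (fun s hs => (hAC s hs).2) ha hc, rfl⟩
end
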